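/- Let k, p, n ∈ ℕ with k ≥ 2, and for each A ∈ T^1_{k−1} let D^A ∈ Λ^{kp} satisfy e^1⌟D^A = 0. Define F_p(ω,α) := Σ_{A∈T^1_{k−1}} ⟨D^A; ω^{p−1}∧α⟩⟨α; e^1∧e^A⟩ for ω, α ∈ Λ^k, and assume F_p(ω, a∧b) = 0 for all ω ∈ Λ^k, a ∈ Λ^1, b ∈ Λ^{k−1}. Then there exists H_p ∈ Λ^{kp+k−1} with e^1⌟H_p = 0 such that F_p(ω,ω) = ⟨e^1∧H_p; ω^{p+1}⟩ for all ω ∈ Λ^k. -/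

import Mathlib

/-! Basic setup: `Λᵏ(ℝⁿ)` in coordinates with respect to the standard basis
`e^I`, `I` a strictly increasing multi-index (modeled as a `k`-element subset of
`Fin n`), together with the exterior product, interior product, inner product,
Hodge star, and the various notions of one-directional convexity/affinity. -/

/-- Increasing multi-indices of length `k` in `{1,…,n}`: `k`-element subsets of `Fin n`.
`Idx n k` plays the role of `T_k`. -/
abbrev Idx (n k : ℕ) := {s : Finset (Fin n) // s.card = k}

/-- `Λᵏ(ℝⁿ)`, identified with its coordinates in the standard basis `e^I`. -/
abbrev Lam (n k : ℕ) := Idx n k → ℝ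

/-- The sign `sgn(R,S)` defined by `e^{[R,S]} = sgn(R,S) e^R ∧ e^S` for disjoint
increasing multi-indices: `(-1)` to the number of inversions between `R` and `S`. -/
def msign {n : ℕ} (R S : Finset (Fin n)) : ℝ :=
  (-1 : ℝ) ^ (((R ×ˢ S).filter (fun p => p.2 < p.1)).card)

/-- The basis form `e^S` (of degree `k = S.card`; zero if `k ≠ S.card`). -/
def bform {n k : ℕ} (S : Finset (Fin n)) : Lam n k :=
  fun I => if I.1 = S then 1 else 0

/-- Exterior (wedge) product in coordinates.  When `m = k + l` this is the wedge
product `Λᵏ × Λˡ → Λ^{k+l}`; for other `m` it is `0`. -/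
def wedge {n k l m : ℕ} (ω : Lam n k) (φ : Lam n l) : Lam n m :=
  fun I => ∑ R : Idx n k, ∑ S : Idx n l,
    if R.1 ∪ S.1 = I.1 ∧ Disjoint R.1 S.1 then msign R.1 S.1 * (ω R * φ S) else 0

/-- Interior product `a ⌟ b`, characterized by `⟨a ⌟ b; c⟩ = ⟨b; a ∧ c⟩`.  When
`m = k - j` this is the interior product `Λʲ × Λᵏ → Λ^{k-j}`; for other `m` it is `0`. -/
def iprod {n j k m : ℕ} (a : Lam n j) (b : Lam n k) : Lam n m :=
  fun C => ∑ A : Idx n j, ∑ B : Idx n k,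
    if A.1 ∪ C.1 = B.1 ∧ Disjoint A.1 C.1 then msign A.1 C.1 * (a A * b B) else 0

/-- Hodge star with respect to the standard orientation; when `m = n - k` this is
`∗ : Λᵏ → Λ^{n-k}`. -/
def hstar {n k m : ℕ} (ω : Lam n k) : Lam n m :=
  fun J => ∑ I : Idx n k, if I.1 = (J.1)ᶜ then msign I.1 J.1 * ω I else 0

/-- Inner product `⟨·;·⟩` on `Λᵏ` (the basis `e^I` is orthonormal). -/
def ip {n k : ℕ} (ω α : Lam n k) : ℝ := ∑ I : Idx n k, ω I * α I

/-- `s`-fold exterior power `ω^s = ω ∧ ⋯ ∧ ω` (with `ω^0 = 1 ∈ Λ⁰`). -/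
def lpow {n k : ℕ} (ω : Lam n k) : (s : ℕ) → Lam n (k * s)
  | 0 => bform ∅
  | s + 1 => wedge ω (lpow ω s)

/-- `f : Λᵏ → ℝ` is ext. one convex. -/
def ExtOneConvex {n k : ℕ} (f : Lam n k → ℝ) : Prop :=
  ∀ (ω : Lam n k) (a : Lam n 1) (b : Lam n (k-1)),
    ConvexOn ℝ Set.univ (fun t : ℝ => f (ω + t • (wedge a b : Lam n k)))

/-- `f : Λᵏ → ℝ` is ext. one affine. -/
def ExtOneAffine {n k : ℕ} (f : Lam n k → ℝ) : Prop :=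
  ExtOneConvex f ∧ ExtOneConvex (fun ω => -f ω)

/-- `f : Λᵏ → ℝ` is int. one convex. -/
def IntOneConvex {n k : ℕ} (f : Lam n k → ℝ) : Prop :=
  ∀ (ω : Lam n k) (a : Lam n 1) (b : Lam n (k+1)),
    ConvexOn ℝ Set.univ (fun t : ℝ => f (ω + t • (iprod a b : Lam n k)))

/-- `f : Λᵏ → ℝ` is int. one affine. -/
def IntOneAffine {n k : ℕ} (f : Lam n k → ℝ) : Prop :=
  IntOneConvex f ∧ IntOneConvex (fun ω => -f ω)

/-- `f : Λ^{k+1} × Λ^{k-1} → ℝ` is ext-int. one convex. -/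
def ExtIntOneConvex {n k : ℕ} (f : Lam n (k+1) → Lam n (k-1) → ℝ) : Prop :=
  ∀ (ξ : Lam n (k+1)) (η : Lam n (k-1)) (a : Lam n 1) (b : Lam n k),
    ConvexOn ℝ Set.univ
      (fun t : ℝ => f (ξ + t • (wedge a b : Lam n (k+1))) (η + t • (iprod a b : Lam n (k-1))))

/-- `f : Λ^{k+1} × Λ^{k-1} → ℝ` is ext-int. one affine. -/
def ExtIntOneAffine {n k : ℕ} (f : Lam n (k+1) → Lam n (k-1) → ℝ) : Prop :=
  ExtIntOneConvex f ∧ ExtIntOneConvex (fun ξ η => -f ξ η)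

/-- `g : Λᵏ → ℝ` is affine, i.e. a constant plus a linear functional. -/
def AffineFn {n k : ℕ} (g : Lam n k → ℝ) : Prop :=
  ∃ (c : ℝ) (a : Lam n k), ∀ ω, g ω = c + ip a ω

section Sign

variable {n : ℕ}

lemma msign_mul_self (R S : Finset (Fin n)) : msign R S * msign R S = 1 := by
  simp [msign, ← mul_pow]

lemma msign_sq (R S : Finset (Fin n)) : msign R S ^ 2 = 1 := by
  rw [pow_two, msign_mul_self]

lemma msign_ne_zero (R S : Finset (Fin n)) : msign R S ≠ 0 := by
  simp [msign]

lemma msign_union_left {R R' : Finset (Fin n)} (h : Disjoint R R') (S : Finset (Fin n)) :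
    msign (R ∪ R') S = msign R S * msign R' S := by
  rw [msign, Finset.union_product, Finset.filter_union, Finset.card_union_of_disjoint, pow_add,
    msign, msign]
  exact Finset.disjoint_filter_filter (Finset.disjoint_product.2 (Or.inl h))

lemma msign_union_right (R : Finset (Fin n)) {S S' : Finset (Fin n)} (h : Disjoint S S') :
    msign R (S ∪ S') = msign R S * msign R S' := by
  rw [msign, Finset.product_union, Finset.filter_union, Finset.card_union_of_disjoint, pow_add,
    msign, msign]
  exact Finset.disjoint_filter_filter (Finset.disjoint_product.2 (Or.inr h))

lemma msign_comm {R S : Finset (Fin n)} (h : Disjoint R S) :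
    msign R S = (-1) ^ (R.card * S.card) * msign S R := by
  have hcard : ((S ×ˢ R).filter (fun p => p.2 < p.1)).card =
      ((R ×ˢ S).filter (fun p => ¬ p.2 < p.1)).card := by
    refine Finset.card_bij' (fun p _ => p.swap) (fun p _ => p.swap) ?_ ?_ ?_ ?_
    · rintro ⟨a, b⟩ hab
      simp only [Finset.mem_filter, Finset.mem_product] at hab
      simp only [Finset.mem_filter, Finset.mem_product, Prod.swap]
      exact ⟨⟨hab.1.2, hab.1.1⟩, not_lt.2 hab.2.le⟩
    · rintro ⟨a, b⟩ hab
      simp only [Finset.mem_filter, Finset.mem_product] at hab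
      simp only [Finset.mem_filter, Finset.mem_product, Prod.swap]
      refine ⟨⟨hab.1.2, hab.1.1⟩, lt_of_le_of_ne (not_lt.1 hab.2) ?_⟩
      rintro rfl
      exact Finset.disjoint_left.1 h hab.1.1 hab.1.2
    · simp
    · simp
  have htot := Finset.card_filter_add_card_filter_not (s := R ×ˢ S) (fun p => p.2 < p.1)
  rw [Finset.card_product] at htot
  rw [msign, msign, hcard, ← htot, pow_add, mul_assoc, ← mul_pow]
  simp

lemma msign_eq_one_of_le {R S : Finset (Fin n)} (h : ∀ r ∈ R, ∀ s ∈ S, r ≤ s) :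
    msign R S = 1 := by
  have : (R ×ˢ S).filter (fun p => p.2 < p.1) = ∅ := by
    ext ⟨a, b⟩
    simp only [Finset.mem_filter, Finset.mem_product, Finset.notMem_empty, iff_false, not_and,
      not_lt]
    exact fun hab => h a hab.1 b hab.2
  simp [msign, this]

end Sign

section LeftMul

variable {n : ℕ}

/-- Exterior multiplication by `e^I` from the left, acting on the full exterior algebra
written in coordinates. -/
def leftMul (I : Finset (Fin n)) : Module.End ℝ (Finset (Fin n) → ℝ) where
  toFun f K := if I ⊆ K then msign I (K \ I) * f (K \ I) else 0
  map_add' f g := by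
    ext K
    by_cases h : I ⊆ K <;> simp [h, mul_add]
  map_smul' c f := by
    ext K
    by_cases h : I ⊆ K <;> simp [h]; ring

lemma leftMul_apply (I : Finset (Fin n)) (f : Finset (Fin n) → ℝ) (K : Finset (Fin n)) :
    leftMul I f K = if I ⊆ K then msign I (K \ I) * f (K \ I) else 0 := rfl

lemma leftMul_empty : leftMul (∅ : Finset (Fin n)) = 1 := by
  ext f K
  simp [leftMul_apply, msign]

lemma leftMul_mul_of_disjoint {I J : Finset (Fin n)} (h : Disjoint I J) :
    leftMul I * leftMul J = msign I J • leftMul (I ∪ J) := by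
  refine LinearMap.ext fun f => funext fun K => ?_
  simp only [Module.End.mul_apply, LinearMap.smul_apply, Pi.smul_apply, smul_eq_mul, leftMul_apply]
  by_cases hIJ : I ∪ J ⊆ K
  · have hI : I ⊆ K := Finset.union_subset_left hIJ
    have hJ : J ⊆ K \ I :=
      Finset.subset_sdiff.2 ⟨Finset.union_subset_right hIJ, h.symm⟩
    have hK : (K \ I) \ J = K \ (I ∪ J) := sdiff_sdiff_left
    have hd : Disjoint J (K \ (I ∪ J)) :=
      Finset.disjoint_of_subset_left Finset.subset_union_right Finset.disjoint_sdiff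
    have hKI : msign I (K \ I) = msign I J * msign I (K \ (I ∪ J)) := by
      rw [← msign_union_right I hd, ← hK, Finset.union_sdiff_of_subset hJ]
    rw [if_pos hI, if_pos hJ, if_pos hIJ, hK, hKI, msign_union_left h]
    ring
  · rw [if_neg hIJ, mul_zero]
    by_cases hI : I ⊆ K
    · have hJ : ¬ J ⊆ K \ I := fun hJ =>
        hIJ (Finset.union_subset hI (hJ.trans Finset.sdiff_subset))
      simp [hJ]
    · simp [hI]

lemma leftMul_mul_of_not_disjoint {I J : Finset (Fin n)} (h : ¬ Disjoint I J) :
    leftMul I * leftMul J = 0 := by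
  refine LinearMap.ext fun f => funext fun K => ?_
  simp only [Module.End.mul_apply, leftMul_apply]
  have : ¬ J ⊆ K \ I := fun hJ => h (Finset.subset_sdiff.1 hJ).2.symm
  simp [this]


lemma leftMul_comm (I J : Finset (Fin n)) :
    leftMul I * leftMul J = (-1 : ℝ) ^ (I.card * J.card) • (leftMul J * leftMul I) := by
  by_cases h : Disjoint I J
  · rw [leftMul_mul_of_disjoint h, leftMul_mul_of_disjoint h.symm, msign_comm h, smul_smul,
      Finset.union_comm]
  · rw [leftMul_mul_of_not_disjoint h,
      leftMul_mul_of_not_disjoint fun h' => h h'.symm, smul_zero]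

/-- The unit of the exterior algebra. -/
def vac : Finset (Fin n) → ℝ := Pi.single ∅ 1

lemma leftMul_vac (I : Finset (Fin n)) : leftMul I vac = Pi.single I 1 := by
  ext K
  rw [leftMul_apply, vac]
  by_cases hK : K = I
  · subst hK
    simp [msign]
  · rw [Pi.single_eq_of_ne hK]
    split_ifs with h
    · rw [Pi.single_eq_of_ne, mul_zero]
      exact fun h' => hK (Finset.Subset.antisymm (Finset.sdiff_eq_empty_iff_subset.1 h') h)
    · rfl

/-- The pairing of a coordinate vector `f` with `X · 1`. -/
def pairing (f : Finset (Fin n) → ℝ) : Module.End ℝ (Finset (Fin n) → ℝ) →ₗ[ℝ] ℝ where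
  toFun X := ∑ S, f S * X vac S
  map_add' X Y := by simp [mul_add, Finset.sum_add_distrib]
  map_smul' c X := by
    simp only [LinearMap.smul_apply, Pi.smul_apply, smul_eq_mul, RingHom.id_apply, Finset.mul_sum]
    exact Finset.sum_congr rfl fun _ _ => by ring

lemma pairing_apply (f : Finset (Fin n) → ℝ) (X : Module.End ℝ (Finset (Fin n) → ℝ)) :
    pairing f X = ∑ S, f S * X vac S := rfl

lemma pairing_leftMul (f : Finset (Fin n) → ℝ) (I : Finset (Fin n)) :
    pairing f (leftMul I) = f I := by
  rw [pairing_apply, leftMul_vac, Finset.sum_eq_single I]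
  · simp
  · intro b _ hb
    simp [hb]
  · simp

lemma pairing_leftMul_mul (f : Finset (Fin n) → ℝ) (I J : Finset (Fin n)) :
    pairing f (leftMul I * leftMul J) = if Disjoint I J then msign I J * f (I ∪ J) else 0 := by
  split_ifs with h
  · rw [leftMul_mul_of_disjoint h, map_smul, pairing_leftMul, smul_eq_mul]
  · rw [leftMul_mul_of_not_disjoint h, map_zero]

end LeftMul

section Forms

variable {n k l m : ℕ}

/-- The coordinates of a `k`-form, extended by zero to index sets of every size. -/
def extCoord (f : Lam n k) : Finset (Fin n) → ℝ :=
  fun S => if h : S.card = k then f ⟨S, h⟩ else 0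

lemma extCoord_val (f : Lam n k) (I : Idx n k) : extCoord f I.1 = f I := by
  simp [extCoord, I.2]

lemma extCoord_of_card_ne (f : Lam n k) {S : Finset (Fin n)} (h : S.card ≠ k) :
    extCoord f S = 0 := by
  simp [extCoord, h]

lemma sum_idx {M : Type*} [AddCommMonoid M] (F : Finset (Fin n) → M)
    (hF : ∀ S : Finset (Fin n), S.card ≠ k → F S = 0) :
    ∑ I : Idx n k, F I.1 = ∑ S, F S := by
  rw [← Finset.sum_subtype (Finset.univ.filter fun S : Finset (Fin n) => S.card = k)
    (by simp) F]
  exact Finset.sum_filter_of_ne fun S _ h => by_contra fun h' => h (hF S h')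

/-- Left exterior multiplication by the form `ω`. -/
def wedgeOp (ω : Lam n k) : Module.End ℝ (Finset (Fin n) → ℝ) :=
  ∑ I : Idx n k, ω I • leftMul I.1

lemma wedgeOp_add (ω φ : Lam n k) : wedgeOp (ω + φ) = wedgeOp ω + wedgeOp φ := by
  simp [wedgeOp, add_smul, Finset.sum_add_distrib]

lemma wedgeOp_bform {S : Finset (Fin n)} (hS : S.card = k) :
    wedgeOp (bform S : Lam n k) = leftMul S := by
  rw [wedgeOp, Finset.sum_eq_single ⟨S, hS⟩]
  · simp [bform]
  · intro b _ hb
    have : b.1 ≠ S := fun h => hb (Subtype.ext h)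
    simp [bform, this]
  · simp

lemma wedgeOp_eq_sum (ω : Lam n k) :
    wedgeOp ω = ∑ S, extCoord ω S • leftMul S := by
  rw [← sum_idx (k := k) (fun S => extCoord ω S • leftMul S)
    fun S hS => by rw [extCoord_of_card_ne _ hS, zero_smul]]
  simp [wedgeOp, extCoord_val]

lemma wedgeOp_vac (ω : Lam n k) : wedgeOp ω vac = extCoord ω := by
  ext K
  simp [wedgeOp_eq_sum, leftMul_vac, Pi.single_apply]

lemma ip_eq_pairing (D ω : Lam n k) : ip D ω = pairing (extCoord D) (wedgeOp ω) := by
  rw [pairing_apply, wedgeOp_vac, ← sum_idx (k := k) (fun S => extCoord D S * extCoord ω S)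
    fun S hS => by rw [extCoord_of_card_ne _ hS, zero_mul]]
  simp [ip, extCoord_val]

lemma wedgeOp_wedge (h : m = k + l) (ω : Lam n k) (φ : Lam n l) :
    wedgeOp (wedge ω φ : Lam n m) = wedgeOp ω * wedgeOp φ := by
  have key : ∀ (R : Idx n k) (S : Idx n l),
      ∑ I : Idx n m, (if R.1 ∪ S.1 = I.1 ∧ Disjoint R.1 S.1 then
        msign R.1 S.1 * (ω R * φ S) else 0) • leftMul I.1 =
      (ω R * φ S) • (leftMul R.1 * leftMul S.1) := by
    intro R S
    by_cases hd : Disjoint R.1 S.1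
    · have hc : (R.1 ∪ S.1).card = m := by
        rw [Finset.card_union_of_disjoint hd, R.2, S.2, h]
      rw [Finset.sum_eq_single ⟨R.1 ∪ S.1, hc⟩]
      · rw [if_pos ⟨rfl, hd⟩, leftMul_mul_of_disjoint hd, smul_smul, mul_comm]
      · intro b _ hb
        have : R.1 ∪ S.1 ≠ b.1 := fun h' => hb (Subtype.ext h'.symm)
        simp [this]
      · simp
    · simp [hd, leftMul_mul_of_not_disjoint hd]
  simp only [wedgeOp, wedge, Finset.sum_smul]
  rw [Finset.sum_comm, Finset.sum_mul_sum]
  refine Finset.sum_congr rfl fun R _ => ?_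
  rw [Finset.sum_comm]
  refine Finset.sum_congr rfl fun S _ => ?_
  rw [key, smul_mul_smul_comm]

lemma wedgeOp_lpow (ω : Lam n k) (s : ℕ) : wedgeOp (lpow ω s) = wedgeOp ω ^ s := by
  induction s with
  | zero => rw [lpow, wedgeOp_bform (by simp), leftMul_empty, pow_zero]
  | succ s ih => rw [lpow, wedgeOp_wedge (by ring), ih, pow_succ']

lemma wedgeOp_comm (ω : Lam n k) (φ : Lam n l) :
    wedgeOp ω * wedgeOp φ = (-1 : ℝ) ^ (k * l) • (wedgeOp φ * wedgeOp ω) := by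
  simp only [wedgeOp, Finset.sum_mul_sum, Finset.smul_sum]
  rw [Finset.sum_comm]
  refine Finset.sum_congr rfl fun S _ => Finset.sum_congr rfl fun R _ => ?_
  rw [smul_mul_smul_comm, smul_mul_smul_comm, leftMul_comm, R.2, S.2, smul_smul, smul_smul]
  congr 1
  ring

lemma commute_wedgeOp (hk : Even k) (ω φ : Lam n k) : Commute (wedgeOp ω) (wedgeOp φ) := by
  rw [Commute, SemiconjBy, wedgeOp_comm, (hk.mul_right k).neg_one_pow, one_smul]

lemma wedgeOp_mul_self_of_odd (hk : Odd k) (ω : Lam n k) : wedgeOp ω * wedgeOp ω = 0 := by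
  have h := wedgeOp_comm ω ω
  rw [(hk.mul hk).neg_one_pow] at h
  have h2 : (2 : ℝ) • (wedgeOp ω * wedgeOp ω) = 0 := by
    rw [two_smul]
    nth_rewrite 1 [h]
    ext f K
    simp
  exact (smul_eq_zero.1 h2).resolve_left two_ne_zero

lemma add_pow_succ_of_mul_self_eq_zero {R : Type*} [Ring R] {a w : R} (ha : a * a = 0)
    (h : Commute a w) (s : ℕ) :
    (a + w) ^ (s + 1) = w ^ (s + 1) + (s + 1) • (a * w ^ s) := by
  induction s with
  | zero => simp [add_comm]
  | succ s ih =>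
    have hw : w * (a * w ^ s) = a * w ^ (s + 1) := by
      rw [← mul_assoc, ← h.eq, mul_assoc, ← pow_succ']
    rw [pow_succ', ih, mul_add, add_mul, add_mul, mul_smul_comm, mul_smul_comm, ← mul_assoc a a, ha,
      zero_mul, smul_zero, zero_add, hw, ← pow_succ', succ_nsmul _ (s + 1)]
    abel

/-- For even `k`, every basis form of degree `k * q` is up to a factor the `q`-th power of a
`k`-form. -/
lemma exists_pow_eq_smul_leftMul (hk0 : 0 < k) {q : ℕ} (hk : Even k ∨ q = 0)
    (S : Finset (Fin n)) (hS : S.card = k * q) :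
    ∃ (ω : Lam n k) (c : ℝ), c ≠ 0 ∧ wedgeOp ω ^ q = c • leftMul S ∧ wedgeOp ω ^ (q + 1) = 0 := by
  induction q generalizing S with
  | zero =>
    refine ⟨0, 1, one_ne_zero, ?_, ?_⟩
    · rw [(Finset.card_eq_zero.1 (by simpa using hS) : S = ∅), leftMul_empty, pow_zero, one_smul]
    · simp [wedgeOp]
  | succ q ih =>
    have hke : Even k := hk.resolve_right (Nat.succ_ne_zero q)
    obtain ⟨C, hCS, hC⟩ := Finset.exists_subset_card_eq (s := S) (n := k)
      (by rw [hS]; exact Nat.le_mul_of_pos_right k q.succ_pos)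
    obtain ⟨ω, c, hc, hω, hω'⟩ := ih (Or.inl hke) (S \ C) (by
      rw [Finset.card_sdiff_of_subset hCS, hS, hC, Nat.mul_succ, Nat.add_sub_cancel])
    have hsq : wedgeOp (bform C : Lam n k) * wedgeOp (bform C : Lam n k) = 0 := by
      rw [wedgeOp_bform hC]
      refine leftMul_mul_of_not_disjoint fun h => ?_
      rw [Finset.disjoint_self_iff_empty] at h
      simp [h] at hC
      omega
    refine ⟨bform C + ω, ((q : ℝ) + 1) * c * msign C (S \ C), ?_, ?_, ?_⟩
    · exact mul_ne_zero (mul_ne_zero (by positivity) hc) (msign_ne_zero _ _)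
    · rw [wedgeOp_add, add_pow_succ_of_mul_self_eq_zero hsq (commute_wedgeOp hke _ _), hω', hω,
        zero_add, wedgeOp_bform hC, mul_smul_comm, leftMul_mul_of_disjoint Finset.disjoint_sdiff,
        Finset.union_sdiff_of_subset hCS]
      rw [← Nat.cast_smul_eq_nsmul ℝ, smul_smul, smul_smul, Nat.cast_succ]
    · rw [wedgeOp_add, add_pow_succ_of_mul_self_eq_zero hsq (commute_wedgeOp hke _ _), hω',
        pow_succ, hω']
      simp

end Forms

section Exchange

variable {n : ℕ}

/-- The polarized form of `F_p` with coefficients `d`, in the second argument restricted to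
`e^T ∧ X`. -/
def polForm (d : Finset (Fin n) → Finset (Fin n) → ℝ) (e : Fin n) (T : Finset (Fin n))
    (X Y : Module.End ℝ (Finset (Fin n) → ℝ)) : ℝ :=
  ∑ A, pairing (d A) (leftMul T * X) * Y vac (insert e A)

/-- The coefficients `d A J` of the forms `D^A` are admissible if they are supported on index sets
of the right sizes which avoid `e`, and if the associated form vanishes at `a ∧ b`. -/
structure Admissible (k q : ℕ) (e : Fin n) (d : Finset (Fin n) → Finset (Fin n) → ℝ) : Prop where
  left_of_mem : ∀ A, e ∈ A → d A = 0
  right_of_mem : ∀ A J, e ∈ J → d A J = 0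
  left_of_card : ∀ A, A.card ≠ k - 1 → d A = 0
  right_of_card : ∀ A J, J.card ≠ k * (q + 1) → d A J = 0
  polForm_eq_zero : ∀ T : Finset (Fin n), T.card = k * q → ∀ (a : Lam n 1) (b : Lam n (k - 1)),
    polForm d e T (wedgeOp a * wedgeOp b) (wedgeOp a * wedgeOp b) = 0

section polForm

variable (d : Finset (Fin n) → Finset (Fin n) → ℝ) (e : Fin n) (T : Finset (Fin n))

lemma polForm_add_left (X X' Y : Module.End ℝ (Finset (Fin n) → ℝ)) :
    polForm d e T (X + X') Y = polForm d e T X Y + polForm d e T X' Y := by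
  simp [polForm, mul_add, add_mul, Finset.sum_add_distrib]

lemma polForm_add_right (X Y Y' : Module.End ℝ (Finset (Fin n) → ℝ)) :
    polForm d e T X (Y + Y') = polForm d e T X Y + polForm d e T X Y' := by
  simp [polForm, mul_add, Finset.sum_add_distrib]

end polForm

variable {k q : ℕ} {e : Fin n} {d : Finset (Fin n) → Finset (Fin n) → ℝ}

lemma polForm_mul_left (T : Finset (Fin n)) {x : Fin n} {V : Finset (Fin n)} (hx : x ∉ V)
    (Y : Module.End ℝ (Finset (Fin n) → ℝ)) :
    polForm d e T (leftMul {x} * leftMul V) Y =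
      msign {x} V * polForm d e T (leftMul ({x} ∪ V)) Y := by
  rw [leftMul_mul_of_disjoint (Finset.disjoint_singleton_left.2 hx)]
  simp [polForm, Finset.mul_sum, mul_assoc]

lemma polForm_mul_right (T : Finset (Fin n)) {x : Fin n} {V : Finset (Fin n)} (hx : x ∉ V)
    (X : Module.End ℝ (Finset (Fin n) → ℝ)) :
    polForm d e T X (leftMul {x} * leftMul V) =
      msign {x} V * polForm d e T X (leftMul ({x} ∪ V)) := by
  rw [leftMul_mul_of_disjoint (Finset.disjoint_singleton_left.2 hx)]
  simp [polForm, Finset.mul_sum, mul_left_comm]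

lemma polForm_leftMul_of_notMem (T : Finset (Fin n)) {K : Finset (Fin n)} (hK : e ∉ K)
    (X : Module.End ℝ (Finset (Fin n) → ℝ)) :
    polForm d e T X (leftMul K) = 0 := by
  refine Finset.sum_eq_zero fun A _ => ?_
  have : insert e A ≠ K := by
    rintro rfl
    exact hK (Finset.mem_insert_self e A)
  rw [leftMul_vac, Pi.single_eq_of_ne this, mul_zero]

/-- A `(k - 1)`-element subset `C` of `J` leaves a remainder made up of `q` blocks of size `k`. -/
lemma exists_split {J : Finset (Fin n)} (hk : 2 ≤ k) (hJ : J.card + 1 = k * (q + 1)) :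
    ∃ T C : Finset (Fin n), T ∪ C = J ∧ Disjoint T C ∧ T.card = k * q ∧ C.card = k - 1 := by
  rw [Nat.mul_succ] at hJ
  obtain ⟨C, hCJ, hC⟩ := Finset.exists_subset_card_eq (s := J) (n := k - 1) (by omega)
  refine ⟨J \ C, C, Finset.sdiff_union_of_subset hCJ, Finset.sdiff_disjoint, ?_, hC⟩
  rw [Finset.card_sdiff_of_subset hCJ, hC]
  omega

namespace Admissible

lemma polForm_leftMul_of_mem (hd : Admissible k q e d) (T : Finset (Fin n)) {K : Finset (Fin n)}
    (hK : e ∈ K) (X : Module.End ℝ (Finset (Fin n) → ℝ)) :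
    polForm d e T X (leftMul K) = pairing (d (K.erase e)) (leftMul T * X) := by
  rw [polForm, Finset.sum_eq_single (K.erase e)]
  · simp [leftMul_vac, Finset.insert_erase hK]
  · intro A _ hA
    by_cases he : e ∈ A
    · simp [hd.left_of_mem A he, pairing_apply]
    · have : insert e A ≠ K := by
        rintro rfl
        exact hA (Finset.erase_insert he).symm
      rw [leftMul_vac, Pi.single_eq_of_ne this, mul_zero]
  · simp

lemma polForm_eq_zero_of_mem_left (hd : Admissible k q e d) (T : Finset (Fin n))
    {K : Finset (Fin n)} (hK : e ∈ K) (Y : Module.End ℝ (Finset (Fin n) → ℝ)) :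
    polForm d e T (leftMul K) Y = 0 := by
  refine Finset.sum_eq_zero fun A _ => ?_
  rw [pairing_leftMul_mul, hd.right_of_mem A _ (Finset.mem_union_right T hK)]
  simp

lemma polForm_leftMul_leftMul (hd : Admissible k q e d) {T J K : Finset (Fin n)} (hK : e ∈ K)
    (hT : Disjoint T J) :
    polForm d e T (leftMul J) (leftMul K) = msign T J * d (K.erase e) (T ∪ J) := by
  rw [hd.polForm_leftMul_of_mem T hK, pairing_leftMul_mul, if_pos hT]

/-- The vanishing of the form at sums of two basis elements. -/
lemma polForm_basis (hd : Admissible k q e d) {T : Finset (Fin n)} (hT : T.card = k * q)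
    (x y : Fin n) {U V : Finset (Fin n)} (hU : U.card = k - 1) (hV : V.card = k - 1) :
    polForm d e T ((leftMul {x} + leftMul {y}) * (leftMul U + leftMul V))
      ((leftMul {x} + leftMul {y}) * (leftMul U + leftMul V)) = 0 := by
  have := hd.polForm_eq_zero T hT (bform {x} + bform {y}) (bform U + bform V)
  rwa [wedgeOp_add, wedgeOp_add, wedgeOp_bform (by simp), wedgeOp_bform (by simp),
    wedgeOp_bform hU, wedgeOp_bform hV] at this

/-- The vanishing of the form at `(e^x + e^y) ∧ (e^e ∧ e^U + e^V)`. -/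
lemma basis_relation (hd : Admissible k q e d) {T U V : Finset (Fin n)} {x y : Fin n}
    (hT : T.card = k * q) (hU : U.card = k - 2) (hV : V.card = k - 1) (hk : 2 ≤ k)
    (hx : x ≠ e) (hy : y ≠ e) (heU : e ∉ U) (heV : e ∉ V) (hxU : x ∉ U) (hyU : y ∉ U)
    (hxV : x ∉ V) (hyV : y ∉ V) (hTV : Disjoint T V) (hxT : x ∉ T) (hyT : y ∉ T) :
    let c := fun u v : Fin n => msign {u} V * msign T ({u} ∪ V) * msign {v} (insert e U) *
      d ({v} ∪ U) ({u} ∪ (T ∪ V))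
    c x x + c x y + c y x + c y y = 0 := by
  intro c
  have hc : ∀ u v : Fin n, u ∉ T → u ∉ V → v ∉ U → v ≠ e →
      polForm d e T (leftMul {u} * leftMul V) (leftMul {v} * leftMul (insert e U)) = c u v := by
    intro u v huT huV hvU hve
    have hv : v ∉ insert e U := by simp [hve, hvU]
    have hTuV : Disjoint T ({u} ∪ V) :=
      Finset.disjoint_union_right.2 ⟨Finset.disjoint_singleton_right.2 huT, hTV⟩
    have hK : ({v} ∪ insert e U).erase e = {v} ∪ U := by
      ext i
      simp only [Finset.mem_erase, Finset.mem_union, Finset.mem_singleton, Finset.mem_insert]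
      constructor
      · tauto
      · rintro (rfl | h)
        · exact ⟨hve, Or.inl rfl⟩
        · exact ⟨fun h' => heU (h' ▸ h), Or.inr (Or.inr h)⟩
    rw [polForm_mul_left T huV, polForm_mul_right T hv, hd.polForm_leftMul_leftMul (by simp) hTuV,
      hK, Finset.union_left_comm]
    ring
  have h1 : ∀ v : Fin n, v ≠ e → v ∉ V → ∀ X,
      polForm d e T X (leftMul {v} * leftMul V) = 0 := by
    intro v hv hvV X
    rw [polForm_mul_right T hvV, polForm_leftMul_of_notMem, mul_zero]
    simp [hv.symm, heV]
  have h2 : ∀ u : Fin n, u ≠ e → u ∉ U → ∀ Y,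
      polForm d e T (leftMul {u} * leftMul (insert e U)) Y = 0 := by
    intro u hu huU Y
    rw [polForm_mul_left T (by simp [hu, huU]), hd.polForm_eq_zero_of_mem_left, mul_zero]
    simp
  have h := hd.polForm_basis hT x y (U := insert e U) (V := V)
    (by rw [Finset.card_insert_of_notMem heU, hU]; omega) hV
  simp only [add_mul, mul_add, polForm_add_left, polForm_add_right, h1 x hx hxV,
    h1 y hy hyV, h2 x hx hxU, h2 y hy hyU, hc x x hxT hxV hxU hx, hc x y hxT hxV hyU hy,
    hc y x hyT hyV hxU hx, hc y y hyT hyV hyU hy] at h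
  linarith

/-- The coefficients vanish on overlapping index sets. -/
lemma eq_zero_of_not_disjoint (hd : Admissible k q e d) (hk : 2 ≤ k) {A J : Finset (Fin n)}
    (h : ¬ Disjoint A J) : d A J = 0 := by
  by_cases heA : e ∈ A
  · rw [hd.left_of_mem A heA, Pi.zero_apply]
  by_cases heJ : e ∈ J
  · exact hd.right_of_mem A J heJ
  by_cases hA : A.card = k - 1
  swap
  · rw [hd.left_of_card A hA, Pi.zero_apply]
  by_cases hJ : J.card = k * (q + 1)
  swap
  · exact hd.right_of_card A J hJ
  obtain ⟨i, hiA, hiJ⟩ := Finset.not_disjoint_iff.1 h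
  obtain ⟨T, C, hTC, hdisj, hT, hC⟩ := exists_split (J := J.erase i) (q := q) hk
    (by rw [Finset.card_erase_add_one hiJ, hJ])
  have hiTC : i ∉ T ∪ C := by simp [hTC]
  have heTC : e ∉ T ∪ C := by simp [hTC, heJ]
  rw [Finset.mem_union, not_or] at hiTC heTC
  have hie : i ≠ e := fun h' => heA (h' ▸ hiA)
  have := hd.basis_relation (U := A.erase i) hT
    (by rw [Finset.card_erase_of_mem hiA, hA]; omega) hC hk hie hie (by simp [heA]) heTC.2
    (by simp) (by simp) hiTC.2 hiTC.2 hdisj hiTC.1 hiTC.1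
  simp only [hTC, ← Finset.insert_eq, Finset.insert_erase hiA, Finset.insert_erase hiJ] at this
  have h0 : msign {i} C * msign T (insert i C) * msign {i} (insert e (A.erase i)) * d A J = 0 := by
    linarith
  simpa [msign_ne_zero] using h0


/-- Exchanging an index of `A` with an index of `J`. -/
lemma exchange (hd : Admissible k q e d) (hmin : ∀ i, e ≤ i) (hk : 2 ≤ k)
    {A J : Finset (Fin n)} {i j : Fin n}
    (hA : A.card = k - 2) (hJ : J.card + 1 = k * (q + 1)) (hAJ : Disjoint A J) (hij : i ≠ j)
    (heA : e ∉ A) (heJ : e ∉ J) (hie : i ≠ e) (hje : j ≠ e) (hiA : i ∉ A) (hjA : j ∉ A)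
    (hiJ : i ∉ J) (hjJ : j ∉ J) :
    msign ({i} ∪ A) ({j} ∪ J) * d ({i} ∪ A) ({j} ∪ J) =
      msign ({j} ∪ A) ({i} ∪ J) * d ({j} ∪ A) ({i} ∪ J) := by
  obtain ⟨T, C, rfl, hdisj, hT, hC⟩ := exists_split (q := q) hk hJ
  have hiTC := hiJ
  have hjTC := hjJ
  have heTC := heJ
  rw [Finset.mem_union, not_or] at hiTC hjTC heTC
  have h := hd.basis_relation hT hA hC hk hie hje heA heTC.2 hiA hjA hiTC.2 hjTC.2 hdisj
    hiTC.1 hjTC.1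
  have hi0 : d ({i} ∪ A) ({i} ∪ (T ∪ C)) = 0 :=
    hd.eq_zero_of_not_disjoint hk (Finset.not_disjoint_iff.2 ⟨i, by simp, by simp⟩)
  have hj0 : d ({j} ∪ A) ({j} ∪ (T ∪ C)) = 0 :=
    hd.eq_zero_of_not_disjoint hk (Finset.not_disjoint_iff.2 ⟨j, by simp, by simp⟩)
  simp only [hi0, hj0, mul_zero, zero_add, add_zero] at h
  have hS : ∀ v : Fin n, v ≠ e → msign {v} (insert e A) = - msign {v} A := fun v hv => by
    rw [Finset.insert_eq, msign_union_right _ (Finset.disjoint_singleton_left.2 heA),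
      msign_comm (Finset.disjoint_singleton.2 hv), msign_eq_one_of_le (by simpa using hmin v)]
    simp
  have hTu : ∀ u : Fin n, u ∉ C → msign T ({u} ∪ C) = msign T {u} * msign T C := fun u hu =>
    msign_union_right _ (Finset.disjoint_singleton_left.2 hu)
  have hTc : ∀ u : Fin n, u ∉ T → msign T {u} = (-1) ^ T.card * msign {u} T := fun u hu => by
    simpa using msign_comm (Finset.disjoint_singleton_right.2 hu)
  have hAc : ∀ u : Fin n, u ∉ A → msign A {u} = (-1) ^ A.card * msign {u} A := fun u hu => by
    simpa using msign_comm (Finset.disjoint_singleton_right.2 hu)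
  have hl : ∀ u v : Fin n, u ∉ A → v ∉ A → v ∉ T ∪ C → msign ({u} ∪ A) ({v} ∪ (T ∪ C)) =
      msign {u} {v} * (msign {u} T * msign {u} C) * ((-1) ^ A.card * msign {v} A) *
        msign A (T ∪ C) := fun u v hu hv hv' => by
    rw [msign_union_left (Finset.disjoint_singleton_left.2 hu),
      msign_union_right _ (Finset.disjoint_singleton_left.2 hv'),
      msign_union_right _ (Finset.disjoint_singleton_left.2 hv'), msign_union_right {u} hdisj,
      hAc v hv]
    ring
  have hije : msign {i} {j} = - msign {j} {i} := by
    simpa using msign_comm (Finset.disjoint_singleton.2 hij)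
  rw [hl i j hiA hjA hjJ, hl j i hjA hiA hiJ, hije]
  rw [hTu i hiTC.2, hTu j hjTC.2, hTc i hiTC.1, hTc j hjTC.1, hS i hie, hS j hje] at h
  set d₁ := d ({i} ∪ A) ({j} ∪ (T ∪ C))
  set d₂ := d ({j} ∪ A) ({i} ∪ (T ∪ C))
  have h' : msign {i} C * msign {i} T * msign {j} A * d₂ +
      msign {j} C * msign {j} T * msign {i} A * d₁ = 0 := by
    have hne : (-1 : ℝ) ^ T.card * msign T C ≠ 0 := mul_ne_zero (by simp) (msign_ne_zero _ _)
    refine (mul_eq_zero.1 ?_).resolve_left hne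
    linear_combination -h
  have hsq : ∀ x y z : Finset (Fin n) × Finset (Fin n),
      (msign x.1 x.2 * msign y.1 y.2 * msign z.1 z.2) ^ 2 = 1 := fun x y z => by
    simp only [mul_pow, msign_sq, mul_one]
  have hi := hsq ({i}, C) ({i}, T) ({j}, A)
  have hj := hsq ({j}, C) ({j}, T) ({i}, A)
  dsimp only at hi hj
  set P := msign {i} C * msign {i} T * msign {j} A with hP
  set P' := msign {j} C * msign {j} T * msign {i} A with hP'
  have h'' : P' * d₂ + P * d₁ = 0 := by
    linear_combination P * P' * h' - P' * d₂ * hi - P * d₁ * hj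
  rw [hP, hP'] at h''
  linear_combination - msign {j} {i} * (-1) ^ A.card * msign A (T ∪ C) * h''

/-- Up to the sign `msign A J`, the coefficient `d A J` depends only on `A ∪ J`. -/
lemma sign_mul_eq (hd : Admissible k q e d) (hmin : ∀ i, e ≤ i) (hk : 2 ≤ k)
    {I A B : Finset (Fin n)} (hI : I.card + 1 = k * (q + 1) + k) (heI : e ∉ I)
    (hAI : A ⊆ I) (hBI : B ⊆ I) (hA : A.card = k - 1) (hB : B.card = k - 1) :
    msign A (I \ A) * d A (I \ A) = msign B (I \ B) * d B (I \ B) := by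
  induction hm : (A \ B).card generalizing A with
  | zero =>
    have hAB : A ⊆ B := Finset.sdiff_eq_empty_iff_subset.1 (Finset.card_eq_zero.1 hm)
    rw [Finset.eq_of_subset_of_card_le hAB (by rw [hA, hB])]
  | succ m ih =>
    obtain ⟨i, hi⟩ := Finset.card_pos.1 (by omega : 0 < (A \ B).card)
    obtain ⟨j, hj⟩ := Finset.card_pos.1
      (by rw [Finset.card_sdiff_comm (hB.trans hA.symm)]; omega : 0 < (B \ A).card)
    rw [Finset.mem_sdiff] at hi hj
    have hij : i ≠ j := fun h => hj.2 (h ▸ hi.1)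
    have hiI := hAI hi.1
    have hjI := hBI hj.1
    have hsub : insert j (A.erase i) ⊆ I :=
      Finset.insert_subset hjI ((Finset.erase_subset i A).trans hAI)
    have hcard : (insert j (A.erase i)).card = k - 1 := by
      rw [Finset.card_insert_of_notMem (by simp [hj.2]), Finset.card_erase_add_one hi.1, hA]
    rw [← ih hsub hcard]
    · have hJ : I \ A = {j} ∪ (I \ insert j A) := by
        ext x
        by_cases hx : x = j
        · subst hx; simp [hjI, hj.2]
        · simp [hx]
      have hJ' : I \ insert j (A.erase i) = {i} ∪ (I \ insert j A) := by
        ext x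
        by_cases hx : x = i
        · subst hx; simp [hiI, hij]
        · simp [hx]
      have hA' : A = {i} ∪ A.erase i := by rw [← Finset.insert_eq, Finset.insert_erase hi.1]
      have hcardJ : (I \ insert j A).card + 1 = k * (q + 1) := by
        rw [Finset.card_sdiff_of_subset (Finset.insert_subset hjI hAI),
          Finset.card_insert_of_notMem hj.2, hA]
        have : 0 < k * (q + 1) := by positivity
        omega
      have hx := hd.exchange hmin hk (A := A.erase i) (J := I \ insert j A) (i := i) (j := j)
        (by rw [Finset.card_erase_of_mem hi.1, hA]; omega) hcardJ
        (Finset.disjoint_of_subset_left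
          ((Finset.erase_subset i A).trans (Finset.subset_insert j A)) Finset.disjoint_sdiff)
        hij (fun h => heI (hAI (Finset.mem_of_mem_erase h))) (fun h => heI (Finset.mem_sdiff.1 h).1)
        (fun h => heI (h ▸ hiI)) (fun h => heI (h ▸ hjI)) (by simp) (by simp [hj.2])
        (by simp [hi.1]) (by simp)
      rwa [← hA', ← hJ, ← hJ', ← Finset.insert_eq] at hx
    · have : insert j (A.erase i) \ B = (A \ B).erase i := by
        ext x
        by_cases hx : x = j
        · subst hx; simp [hj.1]
        · simp [hx, and_assoc]
      rw [this, Finset.card_erase_of_mem (Finset.mem_sdiff.2 hi), hm, Nat.add_sub_cancel]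

/-- The coefficients come from a single form of degree `k * (q + 1) + k - 1`. -/
lemma exists_eq_msign_mul (hd : Admissible k q e d) (hmin : ∀ i, e ≤ i) (hk : 2 ≤ k) :
    ∃ H : Lam n (k * (q + 1) + k - 1), (∀ I, e ∈ I → extCoord H I = 0) ∧
      ∀ A J, A.card = k - 1 → J.card = k * (q + 1) →
        d A J = if Disjoint A J then msign A J * extCoord H (A ∪ J) else 0 := by
  have hex : ∀ I : Idx n (k * (q + 1) + k - 1), e ∉ I.1 → ∃ c : ℝ, ∀ A ⊆ I.1,
      A.card = k - 1 → msign A (I.1 \ A) * d A (I.1 \ A) = c := by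
    intro I heI
    have hI := I.2
    obtain ⟨B, hBI, hB⟩ := Finset.exists_subset_card_eq (s := I.1) (n := k - 1) (by omega)
    exact ⟨_, fun A hAI hA => hd.sign_mul_eq hmin hk (by omega) heI hAI hBI hA hB⟩
  choose c hc using hex
  refine ⟨fun I => if h : e ∈ I.1 then 0 else c I h, ?_, ?_⟩
  · intro I hI
    simp [extCoord, hI]
  · intro A J hA hJ
    split_ifs with hAJ
    swap
    · exact hd.eq_zero_of_not_disjoint hk hAJ
    by_cases heA : e ∈ A
    · simp [hd.left_of_mem A heA, extCoord, heA]
    by_cases heJ : e ∈ J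
    · simp [hd.right_of_mem A J heJ, extCoord, heJ]
    have hcard : (A ∪ J).card = k * (q + 1) + k - 1 := by
      rw [Finset.card_union_of_disjoint hAJ, hA, hJ]
      omega
    have heAJ : e ∉ A ∪ J := by simp [heA, heJ]
    have := hc ⟨A ∪ J, hcard⟩ heAJ A Finset.subset_union_left hA
    rw [Finset.union_sdiff_cancel_left hAJ] at this
    simp only [extCoord, hcard, heAJ, dite_true, dite_false]
    rw [← this, ← mul_assoc, msign_mul_self, one_mul]

/-- For odd `k` the coefficients vanish already when `p = 1`. -/
lemma eq_zero_of_odd (hd : Admissible k 0 e d) (hmin : ∀ i, e ≤ i) (hk : 2 ≤ k) (hodd : Odd k) :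
    d = 0 := by
  ext A J
  by_contra hne
  have hAJ : Disjoint A J := by_contra fun h => hne (hd.eq_zero_of_not_disjoint hk h)
  have heA : e ∉ A := fun h => hne (congrFun (hd.left_of_mem A h) J)
  have heJ : e ∉ J := fun h => hne (hd.right_of_mem A J h)
  have hA : A.card = k - 1 := by_contra fun h => hne (congrFun (hd.left_of_card A h) J)
  have hJ : J.card = k := by
    simpa using (by_contra fun h => hne (hd.right_of_card A J h) : J.card = k * (0 + 1))
  obtain ⟨j, hj⟩ := Finset.card_pos.1 (by omega : 0 < J.card)
  obtain ⟨C, hjC, rfl⟩ : ∃ C, j ∉ C ∧ {j} ∪ C = J :=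
    ⟨J.erase j, by simp, by rw [← Finset.insert_eq, Finset.insert_erase hj]⟩
  have hdC : Disjoint {j} C := Finset.disjoint_singleton_left.2 hjC
  have hC : C.card = k - 1 := by
    rw [Finset.card_union_of_disjoint hdC, Finset.card_singleton] at hJ
    omega
  obtain ⟨hAj, hAC⟩ := Finset.disjoint_union_right.1 hAJ
  have hjA : j ∉ A := Finset.disjoint_singleton_right.1 hAj
  have heC : e ∉ C := fun h => heJ (Finset.mem_union_right _ h)
  have hej : e ≠ j := fun h => heJ (by simp [h])
  have hleft : ∀ B : Finset (Fin n), e ∉ B → ∀ Y,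
      polForm d e ∅ (leftMul {e} * leftMul B) Y = 0 := fun B hB Y => by
    rw [polForm_mul_left _ hB, hd.polForm_eq_zero_of_mem_left _ (by simp), mul_zero]
  have hright : ∀ B : Finset (Fin n), e ∉ B → j ∉ B → ∀ X,
      polForm d e ∅ X (leftMul {j} * leftMul B) = 0 := fun B hB hjB X => by
    rw [polForm_mul_right _ hjB, polForm_leftMul_of_notMem _ (by simp [hej, hB]), mul_zero]
  have hmid : ∀ B B' : Finset (Fin n), e ∉ B → j ∉ B' →
      polForm d e ∅ (leftMul {j} * leftMul B') (leftMul {e} * leftMul B) =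
        msign {j} B' * d B ({j} ∪ B') := fun B B' hB hjB' => by
    have hK : ({e} ∪ B).erase e = B := by
      rw [← Finset.insert_eq, Finset.erase_insert hB]
    rw [polForm_mul_left _ hjB', polForm_mul_right _ hB, hd.polForm_leftMul_leftMul (by simp)
      (Finset.disjoint_empty_left _), hK, msign_eq_one_of_le (R := {e}) (by simp [hmin]),
      msign_eq_one_of_le (R := ∅) (by simp), Finset.empty_union]
    ring
  have hself : ∀ B : Finset (Fin n), B.card = k - 1 → d B ({j} ∪ B) = 0 := fun B hB => by
    obtain ⟨b, hb⟩ := Finset.card_pos.1 (by omega : 0 < B.card)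
    exact hd.eq_zero_of_not_disjoint hk
      (Finset.not_disjoint_iff.2 ⟨b, hb, Finset.mem_union_right _ hb⟩)
  have h := hd.polForm_basis (T := ∅) (by simp) e j hA hC
  simp only [add_mul, mul_add, polForm_add_left, polForm_add_right, hleft A heA, hleft C heC,
    hright A heA hjA, hright C heC hjC, hmid A A heA hjA, hmid A C heA hjC, hmid C A heC hjA,
    hmid C C heC hjC, hself A hA, hself C hC, mul_zero, zero_add, add_zero] at h
  have hsym := hd.sign_mul_eq hmin hk (I := {j} ∪ (A ∪ C)) (A := A) (B := C)
    (by
      rw [Finset.card_union_of_disjoint (Finset.disjoint_singleton_left.2 (by simp [hjA, hjC])),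
        Finset.card_union_of_disjoint hAC, hA, hC, Finset.card_singleton]
      omega)
    (by simp [hej, heA, heC]) (fun x hx => by simp [hx]) (fun x hx => by simp [hx]) hA hC
  have hIA : ({j} ∪ (A ∪ C)) \ A = {j} ∪ C := by
    rw [Finset.union_left_comm, Finset.union_sdiff_cancel_left hAJ]
  have hCjA : Disjoint C ({j} ∪ A) := Finset.disjoint_union_right.2 ⟨hdC.symm, hAC.symm⟩
  have hIC : ({j} ∪ (A ∪ C)) \ C = {j} ∪ A := by
    rw [Finset.union_comm A C, Finset.union_left_comm, Finset.union_sdiff_cancel_left hCjA]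
  have heven : Even (k - 1) := Nat.Odd.sub_odd hodd odd_one
  rw [hIA, hIC, msign_union_right _ hdC, msign_union_right _ (hAj.symm), msign_comm hAC,
    msign_comm hAj, msign_comm hdC.symm, hA, hC, (heven.mul_right _).neg_one_pow,
    (heven.mul_right _).neg_one_pow] at hsym
  have hsym' : msign {j} A * d A ({j} ∪ C) = msign {j} C * d C ({j} ∪ A) := by
    refine mul_left_cancel₀ (msign_ne_zero C A) ?_
    linear_combination hsym
  have h1 := msign_sq {j} A
  have h2 := msign_sq {j} C
  refine hne ?_
  rw [Pi.zero_apply, Pi.zero_apply]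
  linear_combination msign {j} C / 2 * h + msign {j} A / 2 * hsym' -
    d A ({j} ∪ C) / 2 * h1 - d A ({j} ∪ C) / 2 * h2

end Admissible
end Exchange

section Interior

variable {n k m : ℕ}

lemma iprod_bform_singleton (e : Fin n) (b : Lam n k) (C : Idx n m) :
    (iprod (bform {e} : Lam n 1) b : Lam n m) C =
      if e ∈ C.1 then 0 else msign {e} C.1 * extCoord b ({e} ∪ C.1) := by
  rw [iprod, Finset.sum_eq_single ⟨{e}, Finset.card_singleton e⟩]
  · simp only [bform, if_true, one_mul, Finset.disjoint_singleton_left]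
    rw [Finset.sum_congr rfl fun (B : Idx n k) _ => by rw [← extCoord_val b B],
      sum_idx (fun B => if {e} ∪ C.1 = B ∧ e ∉ C.1 then msign {e} C.1 * extCoord b B else 0)
        fun S hS => by rw [extCoord_of_card_ne b hS]; simp]
    by_cases he : e ∈ C.1 <;> simp [he]
  · intro A _ hA
    have : A.1 ≠ {e} := fun h => hA (Subtype.ext h)
    simp [bform, this]
  · simp

lemma iprod_bform_singleton_eq_zero_iff (hm : k = m + 1) (e : Fin n) (b : Lam n k) :
    (iprod (bform {e} : Lam n 1) b : Lam n m) = 0 ↔ ∀ S, e ∈ S → extCoord b S = 0 := by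
  constructor
  · intro h S hS
    by_cases hc : S.card = k
    swap
    · exact extCoord_of_card_ne b hc
    have := congrFun h ⟨S.erase e, by rw [Finset.card_erase_of_mem hS]; omega⟩
    rw [iprod_bform_singleton, ← Finset.insert_eq, Finset.insert_erase hS] at this
    simpa [msign_ne_zero] using this
  · intro h
    ext C
    rw [iprod_bform_singleton, h _ (by simp)]
    simp

lemma extCoord_wedge_bform_singleton (hm : m = 1 + k) (e : Fin n) (b : Lam n k)
    (K : Finset (Fin n)) :
    extCoord (wedge (bform {e} : Lam n 1) b : Lam n m) K =
      if e ∈ K then msign {e} (K \ {e}) * extCoord b (K \ {e}) else 0 := by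
  rw [← wedgeOp_vac, wedgeOp_wedge hm, wedgeOp_bform (by simp), Module.End.mul_apply, wedgeOp_vac,
    leftMul_apply]
  simp

lemma ip_wedge_bform (hk : k = 1 + (k - 1)) {e : Fin n} (hmin : ∀ i, e ≤ i) (ω : Lam n k)
    {A : Finset (Fin n)} (hA : A.card = k - 1) (he : e ∉ A) :
    ip ω (wedge (bform {e} : Lam n 1) (bform A : Lam n (k - 1))) = extCoord ω (insert e A) := by
  rw [ip_eq_pairing, wedgeOp_wedge hk, wedgeOp_bform (by simp), wedgeOp_bform hA,
    pairing_leftMul_mul, if_pos (by simpa using he), msign_eq_one_of_le (by simp [hmin]), one_mul,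
    Finset.insert_eq]

end Interior

section Main

variable {n k m p : ℕ}

/-- The coefficients of the forms `D^A`, `e ∉ A`, extended by zero to all index sets. -/
def coeffs (e : Fin n) (D : Idx n k → Lam n m) (A : Finset (Fin n)) : Finset (Fin n) → ℝ :=
  if h : A.card = k ∧ e ∉ A then extCoord (D ⟨A, h.1⟩) else 0

lemma coeffs_val {e : Fin n} (D : Idx n k → Lam n m) {A : Idx n k} (h : e ∉ A.1) :
    coeffs e D A.1 = extCoord (D A) := by
  rw [coeffs, dif_pos ⟨A.2, h⟩]

lemma sum_pairing_coeffs (e : Fin n) (D : Idx n k → Lam n m)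
    (X : Module.End ℝ (Finset (Fin n) → ℝ)) (w : Finset (Fin n) → ℝ) :
    ∑ A ∈ Finset.univ.filter (fun A : Idx n k => e ∉ A.1), pairing (extCoord (D A)) X * w A.1 =
      ∑ A, pairing (coeffs e D A) X * w A := by
  rw [← sum_idx (k := k) (fun A => pairing (coeffs e D A) X * w A) fun S hS => by
    simp [coeffs, hS, pairing_apply], Finset.sum_filter]
  refine Finset.sum_congr rfl fun A _ => ?_
  by_cases h : e ∈ A.1
  · simp [coeffs, h, pairing_apply]
  · rw [if_pos h, coeffs_val D h]

lemma wedgeOp_vac_eq_zero_of_mem {e : Fin n} {ω : Lam n k} (hω : ∀ S, e ∈ S → extCoord ω S = 0)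
    {f : Finset (Fin n) → ℝ} (hf : ∀ K, e ∈ K → f K = 0) {K : Finset (Fin n)} (hK : e ∈ K) :
    wedgeOp ω f K = 0 := by
  rw [wedgeOp_eq_sum, LinearMap.sum_apply, Finset.sum_apply]
  refine Finset.sum_eq_zero fun I _ => ?_
  by_cases hI : e ∈ I
  · simp [hω I hI]
  · simp [leftMul_apply, hf (K \ I) (Finset.mem_sdiff.2 ⟨hK, hI⟩)]

lemma wedgeOp_pow_vac_eq_zero_of_mem {e : Fin n} {ω : Lam n k}
    (hω : ∀ S, e ∈ S → extCoord ω S = 0) (s : ℕ) {K : Finset (Fin n)} (hK : e ∈ K) :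
    (wedgeOp ω ^ s) vac K = 0 := by
  induction s generalizing K with
  | zero =>
    have : K ≠ ∅ := Finset.ne_empty_of_mem hK
    simp [vac, this]
  | succ s ih =>
    rw [pow_succ', Module.End.mul_apply]
    exact wedgeOp_vac_eq_zero_of_mem hω (fun K hK => ih hK) hK

/-- Splitting off the part of `ω` that contains `e` gives a formula for the coordinates of
`ω ^ (q + 2)` on index sets containing `e`. -/
lemma pairing_pow_succ (hk : Even k) {e : Fin n} (ω : Lam n k) {F : Finset (Fin n) → ℝ}
    (hF : ∀ K, e ∉ K → F K = 0) (q : ℕ) :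
    pairing F (wedgeOp ω ^ (q + 2)) = (q + 2) *
      ∑ A, if e ∈ A then 0 else
        extCoord ω (insert e A) * pairing F (leftMul (insert e A) * wedgeOp ω ^ (q + 1)) := by
  set a : Lam n k := fun I => if e ∈ I.1 then ω I else 0 with ha
  set z : Lam n k := fun I => if e ∈ I.1 then 0 else ω I with hz
  have hω : ω = a + z := by
    ext I
    by_cases he : e ∈ I.1 <;> simp [ha, hz, he]
  have hae : ∀ S, extCoord a S = if e ∈ S then extCoord ω S else 0 := fun S => by
    by_cases he : e ∈ S <;> simp [ha, he, extCoord]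
  have hze : ∀ S, e ∈ S → extCoord z S = 0 := fun S he => by
    simp [hz, he, extCoord]
  have hsq : wedgeOp a * wedgeOp a = 0 := by
    rw [wedgeOp_eq_sum, Finset.sum_mul_sum]
    refine Finset.sum_eq_zero fun R _ => Finset.sum_eq_zero fun S _ => ?_
    rw [smul_mul_smul_comm, hae, hae]
    by_cases hR : e ∈ R
    · by_cases hS : e ∈ S
      · rw [leftMul_mul_of_not_disjoint (Finset.not_disjoint_iff.2 ⟨e, hR, hS⟩), smul_zero]
      · simp [hS]
    · simp [hR]
  have hcomm := commute_wedgeOp hk a z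
  have hpow := fun s => add_pow_succ_of_mul_self_eq_zero hsq hcomm s
  rw [← wedgeOp_add, ← hω] at hpow
  have hmul : wedgeOp a * wedgeOp ω ^ (q + 1) = wedgeOp a * wedgeOp z ^ (q + 1) := by
    rw [hpow, mul_add, mul_smul_comm, ← mul_assoc, hsq, zero_mul, smul_zero, add_zero]
  have hz0 : pairing F (wedgeOp z ^ (q + 2)) = 0 := by
    rw [pairing_apply]
    refine Finset.sum_eq_zero fun K _ => ?_
    by_cases hK : e ∈ K
    · rw [wedgeOp_pow_vac_eq_zero_of_mem hze _ hK, mul_zero]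
    · rw [hF K hK, zero_mul]
  have hsum : wedgeOp a = ∑ A, if e ∈ A then 0 else
      extCoord ω (insert e A) • leftMul (insert e A) := by
    rw [wedgeOp_eq_sum]
    simp only [hae, ite_smul, zero_smul]
    have hflip : ∀ A : Finset (Fin n), (if e ∈ A then 0 else
        extCoord ω (insert e A) • leftMul (insert e A)) =
        if e ∉ A then extCoord ω (insert e A) • leftMul (insert e A) else 0 := fun A =>
      (ite_not _ _ _).symm
    simp only [hflip]
    rw [← Finset.sum_filter, ← Finset.sum_filter]
    refine Finset.sum_nbij' (fun I => I.erase e) (fun A => insert e A) ?_ ?_ ?_ ?_ ?_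
    · simp
    · simp
    · exact fun I hI => Finset.insert_erase (Finset.mem_filter.1 hI).2
    · exact fun A hA => Finset.erase_insert (Finset.mem_filter.1 hA).2
    · exact fun I hI => by rw [Finset.insert_erase (Finset.mem_filter.1 hI).2]
  rw [hpow (q + 1), map_add, hz0, zero_add, map_nsmul, ← hmul, hsum, Finset.sum_mul, map_sum,
    nsmul_eq_mul]
  congr 1
  · push_cast; ring
  · refine Finset.sum_congr rfl fun A _ => ?_
    split_ifs
    · simp
    · rw [smul_mul_assoc, map_smul, smul_eq_mul]

lemma admissible_coeffs {q : ℕ} (hk : 2 ≤ k) (hkq : Even k ∨ q = 0) {e : Fin n}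
    (hmin : ∀ i, e ≤ i) (D : Idx n (k - 1) → Lam n (k * (q + 1)))
    (hD : ∀ A : Idx n (k - 1), e ∉ A.1 →
      (iprod (bform {e} : Lam n 1) (D A) : Lam n (k * (q + 1) - 1)) = 0)
    (hmain : ∀ (ω : Lam n k) (a : Lam n 1) (b : Lam n (k - 1)),
      ∑ A ∈ Finset.univ.filter (fun A : Idx n (k - 1) => e ∉ A.1),
        ip (D A) (wedge (lpow ω q) (wedge a b : Lam n k) : Lam n (k * (q + 1))) *
          ip (wedge a b : Lam n k)
            (wedge (bform {e} : Lam n 1) (bform A.1 : Lam n (k - 1))) = 0) :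
    Admissible k q e (coeffs e D) where
  left_of_mem A hA := by simp [coeffs, hA]
  right_of_mem A J hJ := by
    rw [coeffs]
    split_ifs with h
    · have hpos : 0 < k * (q + 1) := by positivity
      exact (iprod_bform_singleton_eq_zero_iff (by omega) e _).1 (hD ⟨A, h.1⟩ h.2) J hJ
    · rfl
  left_of_card A hA := by simp [coeffs, hA]
  right_of_card A J hJ := by
    rw [coeffs]
    split_ifs with h
    · exact extCoord_of_card_ne _ hJ
    · rfl
  polForm_eq_zero T hT a b := by
    obtain ⟨ω, c, hc, hω, -⟩ := exists_pow_eq_smul_leftMul (by omega) hkq T hT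
    have hk1 : k = 1 + (k - 1) := by omega
    have h := hmain ω a b
    rw [Finset.sum_congr rfl fun A hA => by
      rw [ip_wedge_bform hk1 hmin _ A.2 (Finset.mem_filter.1 hA).2, ip_eq_pairing,
        wedgeOp_wedge (Nat.mul_succ k q), wedgeOp_lpow, hω, wedgeOp_wedge hk1],
      sum_pairing_coeffs e D _ (fun A => extCoord (wedge a b : Lam n k) (insert e A))] at h
    rw [← wedgeOp_vac, wedgeOp_wedge hk1] at h
    simp only [smul_mul_assoc, map_smul, smul_eq_mul, mul_assoc, ← Finset.mul_sum] at h
    exact (mul_eq_zero.1 h).resolve_left hc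

lemma pairing_insert_mul_wedgeOp {q : ℕ} {e : Fin n} (hmin : ∀ i, e ≤ i)
    {d : Finset (Fin n) → Finset (Fin n) → ℝ} (hd : Admissible k q e d)
    {h F : Finset (Fin n) → ℝ}
    (hdh : ∀ A J, A.card = k - 1 → J.card = k * (q + 1) →
      d A J = if Disjoint A J then msign A J * h (A ∪ J) else 0)
    (hF : ∀ K, e ∉ K → F (insert e K) = h K) {A : Finset (Fin n)} (hA : A.card = k - 1)
    (heA : e ∉ A) (φ : Lam n (k * (q + 1))) :
    pairing F (leftMul (insert e A) * wedgeOp φ) = pairing (d A) (wedgeOp φ) := by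
  rw [wedgeOp, Finset.mul_sum, map_sum, map_sum]
  refine Finset.sum_congr rfl fun J _ => ?_
  rw [mul_smul_comm, map_smul, map_smul, pairing_leftMul, pairing_leftMul_mul]
  congr 1
  by_cases heJ : e ∈ J.1
  · rw [hd.right_of_mem A _ heJ, if_neg (by simp [heJ])]
  · rw [hdh A J.1 hA J.2, Finset.insert_union, hF _ (by simp [heA, heJ]), Finset.insert_eq,
      msign_union_left (Finset.disjoint_singleton_left.2 heA),
      msign_eq_one_of_le (R := {e}) (by simp [hmin]), one_mul]
    simp [heJ]

end Main

/-- **Lemma.** Let `k, p, n ∈ ℕ`, `k ≥ 2`, and for each `A ∈ T¹_{k-1}` let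
`D^A ∈ Λ^{kp}` with `e^1 ⌟ D^A = 0`.  Define
`F_p(ω,α) := ∑_{A ∈ T¹_{k-1}} ⟨D^A; ω^{p-1}∧α⟩⟨α; e^1∧e^A⟩` and assume
`F_p(ω, a∧b) = 0` for all `ω ∈ Λᵏ`, `a ∈ Λ¹`, `b ∈ Λ^{k-1}`.  Then there is
`H_p ∈ Λ^{kp+k-1}` with `e^1 ⌟ H_p = 0` and `F_p(ω,ω) = ⟨e^1 ∧ H_p; ω^{p+1}⟩`
for all `ω ∈ Λᵏ`. -/
theorem stmt16 {n k p : ℕ} (hk : 2 ≤ k) (hp : 1 ≤ p) (hn : 1 ≤ n)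
    (e1 : Fin n) (he1 : (e1 : ℕ) = 0)
    (D : Idx n (k-1) → Lam n (k*p))
    (hD : ∀ A : Idx n (k-1), e1 ∉ A.1 →
      (iprod (bform {e1} : Lam n 1) (D A) : Lam n (k*p - 1)) = 0)
    (hmain : ∀ (ω : Lam n k) (a : Lam n 1) (b : Lam n (k-1)),
      ∑ A ∈ Finset.univ.filter (fun A : Idx n (k-1) => e1 ∉ A.1),
        ip (D A) ((wedge (lpow ω (p-1)) ((wedge a b : Lam n k)) : Lam n (k*p))) *
          ip ((wedge a b : Lam n k)) (wedge (bform {e1} : Lam n 1) (bform A.1 : Lam n (k-1))) = 0) :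
    ∃ H : Lam n (k*p + k - 1),
      (iprod (bform {e1} : Lam n 1) H : Lam n (k*p + k - 1 - 1)) = 0 ∧
      ∀ ω : Lam n k,
        (∑ A ∈ Finset.univ.filter (fun A : Idx n (k-1) => e1 ∉ A.1),
          ip (D A) ((wedge (lpow ω (p-1)) ω : Lam n (k*p))) *
            ip ω (wedge (bform {e1} : Lam n 1) (bform A.1 : Lam n (k-1))))
        = ip ((wedge (bform {e1} : Lam n 1) H : Lam n (k*(p+1)))) (lpow ω (p+1)) := by
  obtain ⟨q, rfl⟩ : ∃ q, p = q + 1 := ⟨p - 1, by omega⟩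
  change ∃ H : Lam n (k*(q+1) + k - 1), _ ∧ ∀ ω : Lam n k,
    (∑ A ∈ Finset.univ.filter (fun A : Idx n (k-1) => e1 ∉ A.1),
      ip (D A) (wedge (lpow ω q) ω : Lam n (k*(q+1))) *
        ip ω (wedge (bform {e1} : Lam n 1) (bform A.1 : Lam n (k-1)))) = _
  have hmin : ∀ i, e1 ≤ i := fun i => Fin.le_def.2 (by omega)
  have hk1 : k = 1 + (k - 1) := by omega
  have hL : ∀ ω : Lam n k,
      ∑ A ∈ Finset.univ.filter (fun A : Idx n (k-1) => e1 ∉ A.1),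
        ip (D A) (wedge (lpow ω q) ω : Lam n (k*(q+1))) *
          ip ω (wedge (bform {e1} : Lam n 1) (bform A.1 : Lam n (k-1))) =
      ∑ A, pairing (coeffs e1 D A) (wedgeOp ω ^ (q + 1)) * extCoord ω (insert e1 A) := by
    intro ω
    rw [← sum_pairing_coeffs e1 D _ fun A => extCoord ω (insert e1 A)]
    refine Finset.sum_congr rfl fun A hA => ?_
    rw [ip_wedge_bform hk1 hmin _ A.2 (Finset.mem_filter.1 hA).2, ip_eq_pairing,
      wedgeOp_wedge (Nat.mul_succ k q), wedgeOp_lpow, ← pow_succ]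
  simp only [hL]
  simp only [ip_eq_pairing, wedgeOp_lpow]
  rcases Nat.even_or_odd k with hke | hko
  · have hd := admissible_coeffs hk (Or.inl hke) hmin D hD hmain
    obtain ⟨H, hHe, hH⟩ := hd.exists_eq_msign_mul hmin hk
    have hdeg : k * (q + 1 + 1) = 1 + (k * (q + 1) + k - 1) := by
      rw [Nat.mul_succ k (q + 1)]
      omega
    have hq : (q : ℝ) + 2 ≠ 0 := by positivity
    set H' : Lam n (k * (q + 1) + k - 1) := ((q : ℝ) + 2)⁻¹ • H with hH'
    have hext : ∀ S, extCoord H' S = ((q : ℝ) + 2)⁻¹ * extCoord H S := fun S => by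
      by_cases hS : S.card = k * (q + 1) + k - 1 <;> simp [extCoord, hS, hH']
    refine ⟨H', (iprod_bform_singleton_eq_zero_iff ?_ e1 H').2 ?_, ?_⟩
    · have : 0 < k * (q + 1) := by positivity
      omega
    · exact fun S hS => by rw [hext, hHe S hS, mul_zero]
    · intro ω
      set F : Finset (Fin n) → ℝ := extCoord (wedge (bform {e1} : Lam n 1) H' :
        Lam n (k * (q + 1 + 1))) with hF
      have hFe : ∀ K, e1 ∉ K → F K = 0 := fun K hK => by
        rw [hF, extCoord_wedge_bform_singleton hdeg, if_neg hK]
      have hFi : ∀ K, e1 ∉ K → (((q : ℝ) + 2) • F) (insert e1 K) = extCoord H K := fun K hK => by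
        rw [Pi.smul_apply, smul_eq_mul, hF, extCoord_wedge_bform_singleton hdeg, if_pos (by simp),
          Finset.insert_eq, Finset.union_sdiff_cancel_left (Finset.disjoint_singleton_left.2 hK),
          msign_eq_one_of_le (by simp [hmin]), one_mul, hext, mul_inv_cancel_left₀ hq]
      rw [pairing_pow_succ hke ω hFe, Finset.mul_sum]
      refine Finset.sum_congr rfl fun A _ => ?_
      by_cases hA : A.card = k - 1 ∧ e1 ∉ A
      · rw [if_neg hA.2, ← wedgeOp_lpow,
          ← pairing_insert_mul_wedgeOp hmin hd hH hFi hA.1 hA.2]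
        simp only [pairing_apply, Pi.smul_apply, smul_eq_mul, mul_assoc, ← Finset.mul_sum]
        ring
      · have h0 : coeffs e1 D A = 0 := by rw [coeffs, dif_neg hA]
        rw [h0]
        by_cases heA : e1 ∈ A
        · simp [heA, pairing_apply]
        · have hA' : (insert e1 A).card ≠ k := by
            rw [Finset.card_insert_of_notMem heA]
            exact fun h => hA ⟨by omega, heA⟩
          simp [extCoord_of_card_ne ω hA', pairing_apply]
  · have hpow : ∀ (ω : Lam n k) (s : ℕ), wedgeOp ω ^ (s + 2) = 0 := fun ω s => by
      rw [pow_add, pow_two, wedgeOp_mul_self_of_odd hko, mul_zero]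
    refine ⟨0, ?_, fun ω => ?_⟩
    · ext C
      simp [iprod]
    · rw [hpow ω q, map_zero]
      rcases Nat.eq_zero_or_pos q with rfl | hq
      · have hd := admissible_coeffs hk (Or.inr rfl) hmin D hD hmain
        simp [hd.eq_zero_of_odd hmin hk hko, pairing_apply]
      · obtain ⟨s, rfl⟩ : ∃ s, q = s + 1 := ⟨q - 1, by omega⟩
        simp [hpow ω s]
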